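/- For λ with |λ| ≤ 1, λ ≠ 1, a > 0, and every nonnegative integer m, the Lerch transcendent satisfies Φ(λ, −m, a) = −β_{m+1}(a,λ)/(m+1), where β_n(a,λ) are the Apostol–Bernoulli functions. -/

import Mathlib

open Complex Set Filter Topology Asymptotics MeasureTheory

/-- The Mellin kernel. -/
noncomputable def lerchKer (a : ℝ) (lam : ℂ) (t : ℝ) : ℂ :=
  Complex.exp (-(a : ℂ) * t) / (1 - lam * Complex.exp (-(t : ℂ)))

/-- The truncated Taylor part. -/
noncomputable def lerchTay (c : ℕ → ℂ) (N : ℕ) (t : ℝ) : ℂ :=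
  ∑ n ∈ Finset.range N, c n • (indicator (Ioc 0 1) (fun t => (t : ℂ) ^ (n : ℂ) : ℝ → ℂ)) t

lemma norm_exp_neg_lt (lam : ℂ) (hlam : ‖lam‖ ≤ 1) {t : ℝ} (ht : 0 < t) :
    ‖lam * Complex.exp (-(t : ℂ))‖ < 1 := by
  have h1 : ‖Complex.exp (-(t : ℂ))‖ < 1 := by
    rw [Complex.norm_exp]; simpa using ht
  rw [norm_mul]
  nlinarith [norm_nonneg lam, norm_nonneg (Complex.exp (-(t : ℂ)))]

lemma den_ne (lam : ℂ) (hlam : ‖lam‖ ≤ 1) {t : ℝ} (ht : 0 < t) :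
    1 - lam * Complex.exp (-(t : ℂ)) ≠ 0 := by
  intro h
  have := norm_exp_neg_lt lam hlam ht
  rw [← sub_eq_zero.mp h] at this
  simp at this

lemma ker_cont (a : ℝ) (lam : ℂ) (hlam : ‖lam‖ ≤ 1) :
    ContinuousOn (lerchKer a lam) (Ioi 0) := by
  unfold lerchKer
  apply ContinuousOn.div
  · fun_prop
  · fun_prop
  · intro t ht; exact den_ne lam hlam ht

lemma ker_top (a : ℝ) (lam : ℂ) (hlam : ‖lam‖ ≤ 1) :
    lerchKer a lam =O[atTop] fun t => Real.exp (-a * t) := by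
  apply IsBigO.of_bound (1 / (1 - Real.exp (-1)))
  filter_upwards [eventually_ge_atTop 1] with t ht
  have he : Real.exp (-1) < 1 := by simp
  have h2 : ‖lam * Complex.exp (-(t : ℂ))‖ ≤ Real.exp (-1) := by
    rw [norm_mul, Complex.norm_exp]
    have : Real.exp ((-(t : ℂ)).re) ≤ Real.exp (-1) := by simpa using ht
    nlinarith [norm_nonneg lam, Real.exp_pos ((-(t : ℂ)).re)]
  have h3 : 1 - Real.exp (-1) ≤ ‖1 - lam * Complex.exp (-(t : ℂ))‖ := by
    have := norm_sub_norm_le (1 : ℂ) (lam * Complex.exp (-(t : ℂ)))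
    rw [norm_one] at this
    linarith
  have h4 : ‖Complex.exp (-(a : ℂ) * t)‖ = Real.exp (-a * t) := by
    rw [Complex.norm_exp]; simp
  unfold lerchKer
  rw [norm_div, h4, Real.norm_eq_abs, abs_of_pos (Real.exp_pos _), div_mul_eq_mul_div, one_mul]
  exact div_le_div_of_nonneg_left (Real.exp_pos _).le (by linarith) h3

lemma tay_meas (c : ℕ → ℂ) (N : ℕ) : LocallyIntegrableOn (lerchTay c N) (Ioi 0) := by
  unfold lerchTay
  induction N with
  | zero => simpa using (continuous_const (y := (0:ℂ))).locallyIntegrable.locallyIntegrableOn (Ioi (0:ℝ))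
  | succ N ih =>
    simp_rw [Finset.sum_range_succ]
    refine ih.add ?_
    have h : LocallyIntegrableOn (fun t : ℝ => (t : ℂ) ^ (N : ℂ)) (Ioi 0) := by
      simp_rw [cpow_natCast]
      exact (by fun_prop : Continuous fun t : ℝ => (t : ℂ) ^ N).locallyIntegrable.locallyIntegrableOn _
    have h2 : LocallyIntegrable (indicator (Ioc 0 1) (fun t => (t : ℂ) ^ (N : ℂ) : ℝ → ℂ)) := by
      simp_rw [cpow_natCast]
      exact (by fun_prop : Continuous fun t : ℝ => (t : ℂ) ^ N).locallyIntegrable.indicator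
        measurableSet_Ioc
    exact (h2.smul (c N)).locallyIntegrableOn _

lemma tay_mellin (c : ℕ → ℂ) (N : ℕ) {s : ℂ} (hs : 0 < s.re) :
    HasMellin (lerchTay c N) s (∑ n ∈ Finset.range N, c n / (s + n)) := by
  unfold lerchTay
  induction N with
  | zero => simp [HasMellin, MellinConvergent, mellin]
  | succ N ih =>
    simp_rw [Finset.sum_range_succ]
    have h := hasMellin_cpow_Ioc (N : ℂ) (s := s) (by simp; positivity)
    have h' := hasMellin_const_smul h.1 (c N)
    have := hasMellin_add ih.1 h'.1
    rw [ih.2, h'.2, h.2] at this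
    simpa [div_eq_mul_inv] using this

lemma rem_zero (a : ℝ) (lam : ℂ) (hlam : ‖lam‖ ≤ 1) (beta : ℕ → ℂ)
    (hbeta : ∃ r : ℝ, 0 < r ∧ ∀ z : ℂ, ‖z‖ < r →
      HasSum (fun n : ℕ => beta n * z ^ n / (Nat.factorial n))
        (z * Complex.exp ((a : ℂ) * z) / (lam * Complex.exp z - 1))) (N : ℕ) :
    (fun t => lerchKer a lam t -
      lerchTay (fun n => (-1) ^ (n + 1) * beta (n + 1) / (Nat.factorial (n + 1))) N t)
      =O[𝓝[>] 0] fun t => t ^ (-(-(N : ℝ))) := by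
  obtain ⟨r, hr, H⟩ := hbeta
  have hb0 : beta 0 = 0 := by
    have h1 := H 0 (by simpa using hr)
    have h2 : HasSum (fun n : ℕ => beta n * (0 : ℂ) ^ n / (Nat.factorial n)) (beta 0) := by
      convert hasSum_single (f := fun n : ℕ => beta n * (0 : ℂ) ^ n / (Nat.factorial n)) 0 ?_ using 1
      · simp
      · intro n hn; simp [hn]
    have := h1.unique h2
    simpa using this.symm
  let f : ℂ → ℂ := fun z => z * Complex.exp ((a : ℂ) * z) / (lam * Complex.exp z - 1)
  let p := FormalMultilinearSeries.ofScalars ℂ (fun n => beta n / (Nat.factorial n : ℂ))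
  have hp : HasFPowerSeriesAt f p 0 := by
    rw [hasFPowerSeriesAt_iff]
    filter_upwards [Metric.ball_mem_nhds (0 : ℂ) hr] with z hz
    rw [zero_add]
    convert! H z (by simpa using hz) using 2 with n
    simp only [p, FormalMultilinearSeries.coeff_ofScalars, smul_eq_mul]
    ring
  have hO := hp.isBigO_sub_partialSum_pow (N + 1)
  have ht : Tendsto (fun t : ℝ => -(t : ℂ)) (𝓝[>] 0) (𝓝 0) := by
    have : Tendsto (fun t : ℝ => -(t : ℂ)) (𝓝 0) (𝓝 (-((0 : ℝ) : ℂ))) :=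
      (by fun_prop : Continuous fun t : ℝ => -(t : ℂ)).tendsto 0
    simp only [ofReal_zero, neg_zero] at this
    exact this.mono_left nhdsWithin_le_nhds
  have hO2 := hO.comp_tendsto ht
  rw [← isBigO_norm_right] at hO2
  have hI : (fun t : ℝ => (t : ℂ)⁻¹) =O[𝓝[>] 0] (fun t : ℝ => ‖(t : ℂ)⁻¹‖) :=
    (isBigO_refl _ _).norm_right
  have hO3 := hO2.mul hI
  have hmem : Ioc (0 : ℝ) 1 ∈ 𝓝[>] (0 : ℝ) := Ioc_mem_nhdsGT one_pos
  rw [← isBigO_norm_right] at hO3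
  refine (hO3.congr' ?_ ?_)
  · filter_upwards [hmem] with t ht
    have ht0 : (t : ℂ) ≠ 0 := by exact_mod_cast ht.1.ne'
    have hd := den_ne lam hlam ht.1
    have hd' : lam * Complex.exp (-(t : ℂ)) - 1 ≠ 0 := by
      intro h; apply hd; linear_combination -h
    simp only [Function.comp, zero_add, f, p, FormalMultilinearSeries.partialSum, lerchTay,
      indicator_of_mem ht, FormalMultilinearSeries.ofScalars_apply_eq, smul_eq_mul, cpow_natCast,
      lerchKer]
    rw [Finset.sum_range_succ', sub_mul, add_mul, Finset.sum_mul, hb0]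
    have e1 : -(t : ℂ) * Complex.exp ((a : ℂ) * -(t : ℂ)) / (lam * Complex.exp (-(t : ℂ)) - 1) * (t : ℂ)⁻¹
        = Complex.exp (-(a : ℂ) * t) / (1 - lam * Complex.exp (-(t : ℂ))) := by
      rw [show (a : ℂ) * -(t : ℂ) = -(a : ℂ) * t by ring]
      field_simp
      ring
    rw [e1]
    simp only [Nat.factorial_zero, zero_div, zero_mul, add_zero]
    congr 1
    apply Finset.sum_congr rfl
    intro n _
    rw [neg_pow (t : ℂ) (n + 1), pow_succ (t : ℂ) n]
    field_simp
  · filter_upwards [hmem] with t ht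
    have ht0 : t ≠ 0 := ht.1.ne'
    simp only [Function.comp, norm_neg, norm_mul, norm_inv, norm_pow, norm_real, norm_norm,
      Real.norm_eq_abs, abs_of_pos ht.1, abs_abs, neg_neg, Real.rpow_natCast]
    field_simp
    ring

lemma gamma_prod {s : ℂ} (hs : 0 < s.re) (N : ℕ) :
    Complex.Gamma (s + N) = (∏ j ∈ Finset.range N, (s + j)) * Complex.Gamma s := by
  induction N with
  | zero => simp
  | succ N ih =>
    have hne : s + N ≠ 0 := by
      intro h
      have := congrArg Complex.re h
      simp at this
      have : (0 : ℝ) ≤ N := by positivity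
      linarith
    rw [Finset.prod_range_succ, mul_right_comm, ← ih, Nat.cast_succ, ← add_assoc,
      Complex.Gamma_add_one _ hne, mul_comm]

lemma lerch_mellin (a : ℝ) (ha : 0 < a) (lam : ℂ) (hlam : ‖lam‖ ≤ 1) (F : ℂ → ℂ)
    (hF' : ∀ s : ℂ, 1 < s.re →
      HasSum (fun n : ℕ => lam ^ n / ((n : ℂ) + (a : ℂ)) ^ s) (F s)) {s : ℂ} (hs : 1 < s.re) :
    Complex.Gamma s * F s = mellin (lerchKer a lam) s := by
  have h := hasSum_mellin (a := fun n : ℕ => lam ^ n) (p := fun n : ℕ => (n : ℝ) + a)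
    (F := lerchKer a lam) (s := s) (fun i => Or.inr (by positivity)) (by linarith) ?_ ?_
  · refine ((hF' s hs).mul_left (Complex.Gamma s)).unique ?_
    convert! h using 2 with n
    push_cast
    rw [mul_div_assoc]
  · intro t ht
    have := (hasSum_geometric_of_norm_lt_one (norm_exp_neg_lt lam hlam ht)).mul_left
      (Complex.exp (-(a : ℂ) * t))
    rw [← div_eq_mul_inv] at this
    convert! this using 2 with n
    push_cast
    rw [mul_pow, ← Complex.exp_nat_mul, mul_left_comm, ← Complex.exp_add]
    congr 2
    ring
  · refine Summable.of_nonneg_of_le (fun n => by positivity) (fun n => ?_)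
      ((Real.summable_one_div_nat_add_rpow a s.re).2 hs)
    rw [abs_of_pos (by positivity : 0 < (n : ℝ) + a), norm_pow]
    gcongr
    exact pow_le_one₀ (norm_nonneg _) hlam

theorem lerch_neg_nat (a : ℝ) (ha : 0 < a) (lam : ℂ) (hlam : ‖lam‖ ≤ 1)
    (hlam1 : lam ≠ 1) (F : ℂ → ℂ) (hF : Differentiable ℂ F)
    (hF' : ∀ s : ℂ, 1 < s.re →
      HasSum (fun n : ℕ => lam ^ n / ((n : ℂ) + (a : ℂ)) ^ s) (F s))
    (beta : ℕ → ℂ)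
    (hbeta : ∃ r : ℝ, 0 < r ∧ ∀ z : ℂ, ‖z‖ < r →
      HasSum (fun n : ℕ => beta n * z ^ n / (Nat.factorial n))
        (z * Complex.exp ((a : ℂ) * z) / (lam * Complex.exp z - 1)))
    (m : ℕ) :
    F (-(m : ℂ)) = -(beta (m + 1)) / ((m : ℂ) + 1) := by
  set c : ℕ → ℂ := fun n => (-1) ^ (n + 1) * beta (n + 1) / (Nat.factorial (n + 1)) with hc
  set R : ℝ → ℂ := fun t => lerchKer a lam t - lerchTay c (m + 1) t with hR
  have hRloc : LocallyIntegrableOn R (Ioi 0) :=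
    ((ker_cont a lam hlam).locallyIntegrableOn measurableSet_Ioi).sub (tay_meas c (m + 1))
  have hRtop : R =O[atTop] fun t => Real.exp (-a * t) := by
    refine (ker_top a lam hlam).congr' ?_ EventuallyEq.rfl
    filter_upwards [eventually_gt_atTop 1] with t ht
    have : t ∉ Ioc (0 : ℝ) 1 := fun h => absurd h.2 (not_le.2 ht)
    simp [hR, lerchTay, indicator_of_notMem this]
  have hRbot := rem_zero a lam hlam beta hbeta (m + 1)
  set U : Set ℂ := {s | -((m + 1 : ℕ) : ℝ) < s.re} with hU
  have hUo : IsOpen U := isOpen_lt continuous_const Complex.continuous_re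
  have hUc : IsPreconnected U := (convex_halfSpace_re_gt _).isPreconnected
  have hRd : ∀ s ∈ U, DifferentiableAt ℂ (mellin R) s := fun s hs =>
    mellin_differentiableAt_of_isBigO_rpow_exp ha hRloc hRtop hRbot hs
  have hRconv : ∀ s ∈ U, MellinConvergent R s := fun s hs =>
    mellinConvergent_of_isBigO_rpow_exp ha hRloc hRtop hRbot hs
  let L : ℂ → ℂ := fun s => Complex.Gamma (s + (m + 1 : ℕ)) * F s
  let Q : ℂ → ℂ := fun s => (∏ j ∈ Finset.range (m + 1), (s + j)) * mellin R s +
    ∑ n ∈ Finset.range (m + 1), c n * ∏ j ∈ (Finset.range (m + 1)).erase n, (s + j)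
  have hL : AnalyticOnNhd ℂ L U := by
    apply DifferentiableOn.analyticOnNhd _ hUo
    intro s hs
    apply DifferentiableAt.differentiableWithinAt
    have hG : DifferentiableAt ℂ Complex.Gamma (s + (m + 1 : ℕ)) := by
      apply Complex.differentiableAt_Gamma
      intro k hk
      have h1 := congrArg Complex.re hk
      have h2 : -((m + 1 : ℕ) : ℝ) < s.re := hs
      have h3 : (0 : ℝ) ≤ k := by positivity
      rw [Complex.add_re, Complex.neg_re, Complex.natCast_re, Complex.natCast_re] at h1
      linarith
    exact (hG.comp s (f := fun s => s + ((m + 1 : ℕ) : ℂ)) (by fun_prop)).mul (hF s)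
  have hQ : AnalyticOnNhd ℂ Q U := by
    apply DifferentiableOn.analyticOnNhd _ hUo
    intro s hs
    apply DifferentiableAt.differentiableWithinAt
    have := hRd s hs
    fun_prop
  have heq : ∀ s : ℂ, 1 < s.re → L s = Q s := by
    intro s hs
    have hs0 : 0 < s.re := by linarith
    have hsU : s ∈ U := by
      show -((m + 1 : ℕ) : ℝ) < s.re
      have : (0 : ℝ) ≤ ((m + 1 : ℕ) : ℝ) := by positivity
      linarith
    have ht := tay_mellin c (m + 1) hs0
    have h := hasMellin_add (hRconv s hsU) ht.1
    have hk : (fun t => R t + lerchTay c (m + 1) t) = lerchKer a lam := by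
      ext t; simp [hR]
    rw [hk] at h
    have h2 := h.2
    rw [ht.2] at h2
    simp only [L, Q]
    rw [gamma_prod hs0, mul_assoc, lerch_mellin a ha lam hlam F hF' hs, h2, mul_add, Finset.mul_sum]
    congr 1
    apply Finset.sum_congr rfl
    intro n hn
    have hne : s + n ≠ 0 := by
      intro h
      have := congrArg Complex.re h
      simp at this
      have : (0 : ℝ) ≤ n := by positivity
      linarith
    rw [← Finset.mul_prod_erase _ _ hn]
    field_simp
  have h2U : (2 : ℂ) ∈ U := by
    show -((m + 1 : ℕ) : ℝ) < (2 : ℂ).re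
    have : (0 : ℝ) ≤ ((m + 1 : ℕ) : ℝ) := by positivity
    simp only [Complex.re_ofNat]
    linarith
  have hev : L =ᶠ[𝓝 2] Q := by
    filter_upwards [(isOpen_lt continuous_const Complex.continuous_re).mem_nhds
      (show (2 : ℂ) ∈ {s : ℂ | (1 : ℝ) < s.re} by simp)] with s hs
    exact heq s hs
  have hmU : (-(m : ℂ)) ∈ U := by
    show -((m + 1 : ℕ) : ℝ) < (-(m : ℂ)).re
    simp
  have key := hL.eqOn_of_preconnected_of_eventuallyEq hQ hUc h2U hev hmU
  have hL' : L (-(m : ℂ)) = F (-(m : ℂ)) := by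
    simp [L]
  have hQ' : Q (-(m : ℂ)) = c m * ((-1) ^ m * (Nat.factorial m : ℂ)) := by
    simp only [Q]
    rw [Finset.prod_eq_zero (i := m) (by simp) (by simp), zero_mul, zero_add,
      Finset.sum_eq_single_of_mem m (by simp)]
    · congr 1
      rw [Finset.range_add_one, Finset.erase_insert (by simp), ← Finset.prod_range_reflect,
        ← Finset.prod_range_add_one_eq_factorial, Nat.cast_prod]
      rw [show ((-1 : ℂ)) ^ m = ∏ j ∈ Finset.range m, (-1 : ℂ) by simp, ← Finset.prod_mul_distrib]
      apply Finset.prod_congr rfl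
      intro j hj
      have hj' := Finset.mem_range.1 hj
      have : ((m - 1 - j : ℕ) : ℂ) = m - 1 - j := by
        rw [Nat.cast_sub (by omega), Nat.cast_sub (by omega)]; simp
      rw [this]; push_cast; ring
    · intro n hn hnm
      rw [Finset.prod_eq_zero (i := m) (by simp [Ne.symm hnm]) (by simp), mul_zero]
  rw [← hL', key, hQ', hc]
  simp only [Nat.factorial_succ]
  push_cast
  have h1 : (m : ℂ) + 1 ≠ 0 := by exact_mod_cast Nat.succ_ne_zero m
  have h2 : (Nat.factorial m : ℂ) ≠ 0 := by exact_mod_cast Nat.factorial_ne_zero m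
  have h3 : ((-1 : ℂ)) ^ m * (-1) ^ m = 1 := by rw [← mul_pow]; simp
  rw [pow_succ]
  field_simp
  linear_combination (-beta (m + 1)) * h3
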